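/- Suppose n ≥ 3 and n ≢ 2 (mod 4). Let T : {1,…,n} → Cl_n be such that T_a ∈ W for every a (i.e. each T_a is a linear combination of products e_S of |S| ≡ 2 (mod 4) distinct generators), and suppose that for every b ∈ {1,…,n} the equation Σ_{a=1}^{n} [ T_a , e_a e_b ] = 0 holds in Cl_n (where [x,y] = xy − yx). Then T_a = 0 for all a. (This is the algebraic uniqueness statement underlying the fact that, in dimensions n ≢ 2 mod 4, a spin connection annihilating the natural bilinear forms and satisfying the Palatini-type equation of motion is unique.) -/

import Mathlib

open scoped BigOperators

/-- The quadratic form `Q(x) = −(x_1² + ⋯ + x_n²)` on `ℂ^n`. -/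
noncomputable def negSumSq (n : ℕ) : QuadraticForm ℂ (Fin n → ℂ) :=
  QuadraticMap.weightedSumSquares ℂ (fun _ : Fin n => (-1 : ℂ))

/-- The generators `e_a` of the Clifford algebra `Cl_n`, satisfying
`e_a e_b + e_b e_a = −2 δ_{ab}`. -/
noncomputable def gen {n : ℕ} (a : Fin n) : CliffordAlgebra (negSumSq n) :=
  CliffordAlgebra.ι (negSumSq n) (Pi.single a 1)

/-- For a subset `S = {s_1 < ⋯ < s_k}`, the product `e_S = e_{s_1} ⋯ e_{s_k}`. -/
noncomputable def genProd {n : ℕ} (S : Finset (Fin n)) : CliffordAlgebra (negSumSq n) :=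
  ((S.sort (· ≤ ·)).map gen).prod

/-- The span `W` of the products `e_S` over subsets `S` with `|S| ≡ 2 (mod 4)`. -/
noncomputable def spanW (n : ℕ) : Submodule ℂ (CliffordAlgebra (negSumSq n)) :=
  Submodule.span ℂ {x | ∃ S : Finset (Fin n), S.card % 4 = 2 ∧ x = genProd S}

open scoped symmDiff

theorem gen_mul_self {n : ℕ} (a : Fin n) : gen a * gen a = -1 := by
  have h : negSumSq n (Pi.single a 1) = -1 := by
    simp [negSumSq, QuadraticMap.weightedSumSquares_apply, Pi.single_apply]
  rw [gen, CliffordAlgebra.ι_sq_scalar, h, map_neg, map_one]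

theorem gen_mul_gen_of_ne {n : ℕ} {a b : Fin n} (h : a ≠ b) :
    gen a * gen b = -(gen b * gen a) := by
  rw [eq_neg_iff_add_eq_zero, gen, gen, CliffordAlgebra.ι_mul_ι_add_swap]
  have h0 : QuadraticMap.polar (negSumSq n) (Pi.single a 1) (Pi.single b 1) = 0 := by
    simp only [QuadraticMap.polar, negSumSq, QuadraticMap.weightedSumSquares_apply,
      ← Finset.sum_sub_distrib]
    refine Finset.sum_eq_zero fun i _ => ?_
    by_cases hi : i = a
    · subst hi; simp [h]
    · simp [hi]
  rw [h0, map_zero]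

theorem eq_zero_of_mul_gen_eq_zero {n : ℕ} {z : CliffordAlgebra (negSumSq n)} {a : Fin n}
    (h : z * gen a = 0) : z = 0 := by
  have h1 : z * gen a * gen a = 0 := by rw [h, zero_mul]
  simpa [mul_assoc, gen_mul_self] using h1

/-- `z` anticommutes with `e_c` for `c ∈ S` and commutes with `e_c` for `c ∉ S`. -/
def HasType {n : ℕ} (S : Finset (Fin n)) (z : CliffordAlgebra (negSumSq n)) : Prop :=
  ∀ c, gen c * z = if c ∈ S then -(z * gen c) else z * gen c

theorem hasType_zero {n : ℕ} (S : Finset (Fin n)) : HasType S 0 := fun c => by simp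

theorem HasType.add {n : ℕ} {S : Finset (Fin n)} {x y : CliffordAlgebra (negSumSq n)}
    (hx : HasType S x) (hy : HasType S y) : HasType S (x + y) := fun c => by
  rw [mul_add, hx c, hy c]
  split_ifs
  · rw [add_mul, neg_add]
  · rw [add_mul]

theorem HasType.smul {n : ℕ} {S : Finset (Fin n)} {x : CliffordAlgebra (negSumSq n)} (r : ℂ)
    (hx : HasType S x) : HasType S (r • x) := fun c => by
  rw [mul_smul_comm, hx c]
  split_ifs <;> simp

theorem HasType.sum {n : ℕ} {ι : Type*} {S : Finset (Fin n)}
    {f : ι → CliffordAlgebra (negSumSq n)} (s : Finset ι) (h : ∀ i ∈ s, HasType S (f i)) :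
    HasType S (∑ i ∈ s, f i) :=
  Finset.sum_induction f (HasType S) (fun _ _ => HasType.add) (hasType_zero S) h

theorem HasType.commutator {n : ℕ} {S : Finset (Fin n)} {z : CliffordAlgebra (negSumSq n)}
    (hz : HasType S z) (a b : Fin n) :
    z * (gen a * gen b) - gen a * gen b * z =
      if a ≠ b ∧ (a ∈ S ↔ b ∉ S) then (2 : ℂ) • (z * gen a * gen b) else 0 := by
  have h : gen a * gen b * z = if (a ∈ S ↔ b ∉ S) then -(z * (gen a * gen b))
      else z * (gen a * gen b) := by
    have ha := hz a
    have hb := hz b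
    by_cases h1 : a ∈ S <;> by_cases h2 : b ∈ S <;>
      simp only [h1, h2, if_true, if_false] at ha hb <;>
      simp [h1, h2, mul_assoc, hb] <;> simp [← mul_assoc, ha]
  rw [h]
  by_cases hab : a = b
  · subst hab
    by_cases h1 : a ∈ S <;> simp [h1]
  · by_cases h1 : (a ∈ S ↔ b ∉ S)
    · rw [if_pos h1, if_pos ⟨hab, h1⟩, two_smul, sub_neg_eq_add, mul_assoc]
    · rw [if_neg h1, if_neg fun h => h1 h.2, sub_self]

theorem HasType.mul_gen_mul_gen {n : ℕ} {S : Finset (Fin n)}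
    {z : CliffordAlgebra (negSumSq n)} (hz : HasType S z) {a b : Fin n} (hab : a ≠ b) :
    HasType (S ∆ {a} ∆ {b}) (z * gen a * gen b) := fun c => by
  have hc := hz c
  rw [mul_assoc, ← mul_assoc (gen c), hc]
  have key : gen c * (gen a * gen b) =
      if c = a ∨ c = b then -(gen a * gen b * gen c) else gen a * gen b * gen c := by
    by_cases h1 : c = a
    · subst h1
      rw [if_pos (Or.inl rfl), mul_assoc (gen c) (gen b), gen_mul_gen_of_ne hab.symm]
      simp
    · by_cases h2 : c = b
      · subst h2
        rw [if_pos (Or.inr rfl), ← mul_assoc, gen_mul_gen_of_ne h1, neg_mul]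
      · rw [if_neg (by tauto), ← mul_assoc, gen_mul_gen_of_ne h1, neg_mul, mul_assoc,
          gen_mul_gen_of_ne h2, mul_neg, neg_neg, mul_assoc]
  have hmem : c ∈ S ∆ {a} ∆ {b} ↔ (c ∈ S ↔ ¬(c = a ∨ c = b)) := by
    simp only [Finset.mem_symmDiff, Finset.mem_singleton]
    have : c = a → c ≠ b := fun h h' => hab (h.symm.trans h')
    tauto
  by_cases h1 : c ∈ S <;> by_cases h2 : c = a ∨ c = b <;>
    simp only [hmem, h1, h2, if_true, if_false] at key ⊢ <;>
    simp [mul_assoc] at key ⊢ <;> simp [key]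

theorem HasType.hasType_commutator {n : ℕ} {S : Finset (Fin n)}
    {z : CliffordAlgebra (negSumSq n)} (hz : HasType S z) (a b : Fin n) :
    HasType (S ∆ {a} ∆ {b}) (z * (gen a * gen b) - gen a * gen b * z) := by
  rw [hz.commutator]
  split_ifs with h
  · exact (hz.mul_gen_mul_gen h.1).smul 2
  · exact hasType_zero _

theorem gen_mul_prod_map_gen {n : ℕ} (c : Fin n) (l : List (Fin n)) (hl : l.Nodup) :
    gen c * (l.map gen).prod =
      ((-1 : ℂ) ^ l.length * if c ∈ l then -1 else 1) • ((l.map gen).prod * gen c) := by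
  induction l with
  | nil => simp
  | cons a l ih =>
    obtain ⟨ha, hl⟩ := List.nodup_cons.1 hl
    have ih := ih hl
    rw [List.map_cons, List.prod_cons, List.length_cons, mul_assoc (gen a)]
    by_cases h : c = a
    · subst h
      rw [if_neg ha] at ih
      rw [if_pos (List.mem_cons_self), ih, mul_smul_comm, pow_succ]
      simp
    · have hm : c ∈ a :: l ↔ c ∈ l := by simp [h]
      rw [← mul_assoc, gen_mul_gen_of_ne h, neg_mul, mul_assoc, ih, mul_smul_comm, ← neg_smul]
      simp only [hm, pow_succ]
      congr 1
      ring

theorem hasType_genProd {n : ℕ} (S : Finset (Fin n)) (hS : Even S.card) :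
    HasType S (genProd S) := fun c => by
  rw [genProd, gen_mul_prod_map_gen c _ (Finset.sort_nodup _ _), Finset.length_sort,
    hS.neg_one_pow, one_mul]
  simp only [Finset.mem_sort]
  split_ifs <;> simp

theorem exists_hasType_decomposition {n : ℕ} {x : CliffordAlgebra (negSumSq n)}
    (hx : x ∈ spanW n) :
    ∃ f : Finset (Fin n) → CliffordAlgebra (negSumSq n), (∀ S, HasType S (f S)) ∧
      (∀ S, S.card % 4 ≠ 2 → f S = 0) ∧ ∑ S, f S = x := by
  induction hx using Submodule.span_induction with
  | mem x h =>
    obtain ⟨S, hS, rfl⟩ := h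
    refine ⟨Pi.single S (genProd S), fun U => ?_, fun U hU => ?_, by simp⟩
    · by_cases h : U = S
      · subst h
        simpa using hasType_genProd U (Nat.even_iff.2 (by omega))
      · simpa [h] using hasType_zero U
    · exact Pi.single_eq_of_ne (fun h : U = S => hU (h ▸ hS)) _
  | zero => exact ⟨0, hasType_zero, fun _ _ => rfl, by simp⟩
  | add x y _ _ hx hy =>
    obtain ⟨f, hf, hf', rfl⟩ := hx
    obtain ⟨g, hg, hg', rfl⟩ := hy
    exact ⟨f + g, fun S => (hf S).add (hg S), fun S h => by simp [hf' S h, hg' S h],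
      by simp [Finset.sum_add_distrib]⟩
  | smul r x _ hx =>
    obtain ⟨f, hf, hf', rfl⟩ := hx
    exact ⟨r • f, fun S => (hf S).smul r, fun S h => by simp [hf' S h], by
      simp [Finset.smul_sum]⟩

theorem gen_mul_mul_gen_sum {n : ℕ} {f : Finset (Fin n) → CliffordAlgebra (negSumSq n)}
    (hf : ∀ S, HasType S (f S)) (s : Finset (Finset (Fin n))) (a : Fin n) :
    gen a * (∑ S ∈ s, f S) * gen a =
      (∑ S ∈ s with a ∈ S, f S) - ∑ S ∈ s with a ∉ S, f S := by
  rw [Finset.mul_sum, Finset.sum_mul, Finset.sum_filter, Finset.sum_filter,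
    ← Finset.sum_sub_distrib]
  refine Finset.sum_congr rfl fun S _ => ?_
  rw [hf S a]
  by_cases h : a ∈ S <;> simp [h, mul_assoc, gen_mul_self]

theorem eq_zero_of_sum_eq_zero_of_hasType {n : ℕ}
    {f : Finset (Fin n) → CliffordAlgebra (negSumSq n)} (hf : ∀ S, HasType S (f S))
    (h : ∑ S, f S = 0) (U : Finset (Fin n)) : f U = 0 := by
  have key : ∀ A : Finset (Fin n),
      ∑ S : Finset (Fin n) with ∀ c ∈ A, (c ∈ S ↔ c ∈ U), f S = 0 := by
    intro A
    induction A using Finset.induction_on with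
    | empty => simpa using h
    | insert a A ha ih =>
      have h1 := gen_mul_mul_gen_sum hf
        (Finset.univ.filter fun S => ∀ c ∈ A, (c ∈ S ↔ c ∈ U)) a
      have h2 := Finset.sum_filter_add_sum_filter_not
        (Finset.univ.filter fun S : Finset (Fin n) => ∀ c ∈ A, (c ∈ S ↔ c ∈ U))
        (fun S => a ∈ S) f
      rw [ih] at h1 h2
      rw [mul_zero, zero_mul] at h1
      have h3 := sub_eq_zero.1 h1.symm
      rw [← h3, ← two_smul ℂ, smul_eq_zero_iff_right two_ne_zero] at h2
      rw [h2] at h3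
      rw [Finset.filter_filter] at h2 h3
      by_cases hU : a ∈ U
      · rw [← h2]
        congr 1
        ext S
        simp [hU, and_comm]
      · rw [h3]
        congr 1
        ext S
        simp [hU, and_comm]
  have hU := key Finset.univ
  have : (Finset.univ.filter fun S : Finset (Fin n) =>
      ∀ c ∈ (Finset.univ : Finset (Fin n)), (c ∈ S ↔ c ∈ U)) = {U} := by
    ext S
    simp [Finset.ext_iff]
  rwa [this, Finset.sum_singleton] at hU

theorem eq_zero_of_sum_erase_eq_zero {ι M : Type*} [DecidableEq ι] [AddCommGroup M] [Module ℂ M]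
    {s : Finset ι} (hs : 1 < s.card) {y : ι → M} (h : ∀ b ∈ s, ∑ a ∈ s.erase b, y a = 0)
    {a : ι} (ha : a ∈ s) : y a = 0 := by
  have hy : ∀ b ∈ s, y b = ∑ a ∈ s, y a := fun b hb => by
    rw [← Finset.add_sum_erase s y hb, h b hb, add_zero]
  have h1 : ∑ a ∈ s, y a = (s.card : ℂ) • ∑ a ∈ s, y a := by
    conv_lhs => rw [Finset.sum_congr rfl hy, Finset.sum_const]
    rw [Nat.cast_smul_eq_nsmul]
  have h2 : ((s.card : ℂ) - 1) • ∑ a ∈ s, y a = 0 := by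
    rw [sub_smul, one_smul, ← h1, sub_self]
  rw [hy a ha]
  refine (smul_eq_zero.1 h2).resolve_left (sub_ne_zero.2 ?_)
  exact_mod_cast hs.ne'

/-- In dimensions `n ≢ 2 (mod 4)`, any `T` with each `T_a` of Clifford order
`≡ 2 (mod 4)` satisfying `Σ_a [T_a, e_a e_b] = 0` for all `b` must vanish. -/
theorem stmt6 {n : ℕ} (hn : 3 ≤ n) (hmod : n % 4 ≠ 2)
    (T : Fin n → CliffordAlgebra (negSumSq n))
    (hT : ∀ a, T a ∈ spanW n)
    (heq : ∀ b : Fin n,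
      ∑ a : Fin n, (T a * (gen a * gen b) - (gen a * gen b) * T a) = 0) :
    ∀ a, T a = 0 := by
  choose f hf hf0 hfT using fun a => exists_hasType_decomposition (hT a)
  have hcomp : ∀ b U, ∑ a, (f a (U ∆ {b} ∆ {a}) * (gen a * gen b) -
      gen a * gen b * f a (U ∆ {b} ∆ {a})) = 0 := by
    intro b
    refine eq_zero_of_sum_eq_zero_of_hasType (fun U => HasType.sum _ fun a _ => ?_) ?_
    · have := (hf a (U ∆ {b} ∆ {a})).hasType_commutator a b
      rwa [symmDiff_symmDiff_cancel_right, symmDiff_symmDiff_cancel_right] at this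
    · rw [Finset.sum_comm, ← heq b]
      refine Finset.sum_congr rfl fun a _ => ?_
      have hinv : Function.Involutive fun U : Finset (Fin n) => U ∆ ({b} ∆ {a}) :=
        fun U => symmDiff_symmDiff_cancel_right _ _
      rw [← hfT a, Finset.sum_mul, Finset.mul_sum, ← Finset.sum_sub_distrib]
      simp only [symmDiff_assoc]
      exact hinv.toPerm.sum_comp Finset.univ
        (fun S => f a S * (gen a * gen b) - gen a * gen b * f a S) (by simp)
  have hclass : ∀ V b, ∑ a with a ≠ b ∧ (a ∈ V ↔ b ∈ V), f a (V ∆ {a}) * gen a = 0 := by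
    intro V b
    have h := hcomp b (V ∆ {b})
    rw [symmDiff_symmDiff_cancel_right] at h
    simp only [(hf _ _).commutator] at h
    rw [← Finset.sum_filter, ← Finset.smul_sum, ← Finset.sum_mul,
      smul_eq_zero_iff_right two_ne_zero] at h
    rw [← eq_zero_of_mul_gen_eq_zero h]
    congr 1
    ext a
    simp only [Finset.mem_filter, Finset.mem_univ, true_and, Finset.mem_symmDiff,
      Finset.mem_singleton]
    have : a = b ↔ b = a := eq_comm
    tauto
  intro a
  rw [← hfT a]
  refine Finset.sum_eq_zero fun S _ => ?_
  by_cases hS : S.card % 4 = 2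
  swap
  · exact hf0 a S hS
  obtain ⟨b, hb⟩ : ∃ b, b ∈ S ↔ a ∉ S := by
    by_contra! h
    by_cases ha : a ∈ S
    · have : S = Finset.univ := Finset.eq_univ_iff_forall.2 fun b => by have := h b; tauto
      rw [this, Finset.card_univ, Fintype.card_fin] at hS
      exact hmod hS
    · have : S = ∅ := Finset.eq_empty_iff_forall_notMem.2 fun b => by have := h b; tauto
      simp [this] at hS
  have hab : b ≠ a := by rintro rfl; tauto
  have hV := eq_zero_of_sum_erase_eq_zero
    (s := Finset.univ.filter fun c => c ∈ S ∆ {a} ↔ a ∈ S ∆ {a})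
    (y := fun c => f c (S ∆ {a} ∆ {c}) * gen c) (a := a)
    (Finset.one_lt_card.2 ⟨a, by simp, b, by simp [Finset.mem_symmDiff, hab, hb], hab.symm⟩)
    (fun b hb => by
      rw [← hclass (S ∆ {a}) b]
      congr 1
      ext c
      simp only [Finset.mem_filter, Finset.mem_univ, true_and, Finset.mem_erase] at hb ⊢
      rw [hb]) (by simp)
  simp only [symmDiff_symmDiff_cancel_right] at hV
  exact eq_zero_of_mul_gen_eq_zero hV
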